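/- For integers N ≥ 0, ν ≥ 0, the family of vectors φ^{(l,λ)} in ℂ^{N+1} ⊗ ℂ^{ν+1} indexed by l ∈ {−N,…,ν} and λ ∈ {0,…,𝒞_l−1}, defined by components φ^{(l,λ)}_{(N−k, k+l)} = e^{2πi λ k / 𝒞_l} / √𝒞_l for max{0,−l} ≤ k ≤ min{N, ν−l} and all other components zero, is an orthonormal family: ⟨φ^{(l,λ)}, φ^{(l',λ')}⟩ = 1 if (l,λ)=(l',λ') and 0 otherwise. Since the family has cardinality ∑_l 𝒞_l = (N+1)(ν+1), it is an orthonormal basis of ℂ^{N+1} ⊗ ℂ^{ν+1}. -/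

import Mathlib

open scoped BigOperators

/-- Orthogonality of the additive characters of `ℤ/cℤ`, summed over a window of length `c`. -/
theorem sum_range_exp_two_pi_mul_I_mul_div {c : ℕ} (hc : 0 < c) (d m : ℤ) :
    ∑ j ∈ Finset.range c, Complex.exp (2 * Real.pi * Complex.I * d * ((m + j : ℤ) : ℂ) / c) =
      if (c : ℤ) ∣ d then (c : ℂ) else 0 := by
  have hc0 : (c : ℂ) ≠ 0 := by exact_mod_cast hc.ne'
  split_ifs with h
  · obtain ⟨e, rfl⟩ := h
    have hterm : ∀ j ∈ Finset.range c,
        Complex.exp (2 * Real.pi * Complex.I * ((c * e : ℤ) : ℂ) * ((m + j : ℤ) : ℂ) / c) = 1 := by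
      intro j _
      rw [Complex.exp_eq_one_iff]
      refine ⟨e * (m + j), ?_⟩
      push_cast
      field_simp
    rw [Finset.sum_congr rfl hterm]
    simp
  · set z : ℂ := Complex.exp (2 * Real.pi * Complex.I * d / c) with hz
    have hz1 : z ≠ 1 := by
      rw [hz, Ne, Complex.exp_eq_one_iff]
      rintro ⟨n, hn⟩
      apply h
      refine ⟨n, ?_⟩
      have h2 : (2 * Real.pi * Complex.I : ℂ) ≠ 0 := Complex.two_pi_I_ne_zero
      have h3 : (2 * Real.pi * Complex.I : ℂ) * d = (2 * Real.pi * Complex.I) * (c * n) := by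
        rw [div_eq_iff hc0] at hn
        rw [hn]
        ring
      exact_mod_cast mul_left_cancel₀ h2 h3
    have hzc : z ^ c = 1 := by
      rw [hz, ← Complex.exp_nat_mul, Complex.exp_eq_one_iff]
      refine ⟨d, ?_⟩
      field_simp
    have hterm : ∀ j ∈ Finset.range c,
        Complex.exp (2 * Real.pi * Complex.I * d * ((m + j : ℤ) : ℂ) / c) =
          Complex.exp (2 * Real.pi * Complex.I * d * m / c) * z ^ j := by
      intro j _
      rw [hz, ← Complex.exp_nat_mul, ← Complex.exp_add]
      congr 1
      push_cast
      ring
    rw [Finset.sum_congr rfl hterm, ← Finset.mul_sum, geom_sum_eq hz1, hzc]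
    simp

/-- A sum over a diagonal of the rectangle `{0,…,N} × {0,…,ν}`, reindexed by an interval. -/
theorem sum_antidiagonal_rectangle {N ν c : ℕ} {l : ℤ}
    (hc : (c : ℤ) = min (N : ℤ) ((ν : ℤ) - l) - max 0 (-l) + 1) (f : ℤ → ℂ) :
    (∑ p : Fin (N + 1) × Fin (ν + 1),
      if ((p.2 : ℕ) : ℤ) = ((N : ℤ) - ((p.1 : ℕ) : ℤ)) + l ∧
          max 0 (-l) ≤ (N : ℤ) - ((p.1 : ℕ) : ℤ) ∧
          (N : ℤ) - ((p.1 : ℕ) : ℤ) ≤ min (N : ℤ) ((ν : ℤ) - l)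
      then f ((N : ℤ) - ((p.1 : ℕ) : ℤ)) else 0) =
      ∑ j ∈ Finset.range c, f (max 0 (-l) + j) := by
  rw [← Finset.sum_filter]
  refine Finset.sum_bij (fun p _ => ((N : ℤ) - ((p.1 : ℕ) : ℤ) - max 0 (-l)).toNat) ?_ ?_ ?_ ?_
  · rintro ⟨a, b⟩ hp
    simp only [Finset.mem_filter, Finset.mem_univ, true_and, Finset.mem_range] at hp ⊢
    omega
  · rintro ⟨a, b⟩ hp ⟨a', b'⟩ hp' h
    simp only [Finset.mem_filter, Finset.mem_univ, true_and] at hp hp' h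
    rw [Prod.mk.injEq, Fin.ext_iff, Fin.ext_iff]
    omega
  · intro j hj
    rw [Finset.mem_range] at hj
    refine ⟨(⟨(N - (max 0 (-l) + j)).toNat, by omega⟩, ⟨(max 0 (-l) + j + l).toNat, by omega⟩),
      ?_, ?_⟩
    · simp only [Finset.mem_filter, Finset.mem_univ, true_and]
      omega
    · simp only
      omega
  · rintro ⟨a, b⟩ hp
    simp only [Finset.mem_filter, Finset.mem_univ, true_and] at hp ⊢
    congr 1
    omega

/-- Orthonormality of the measurement basis `φ^{(l,λ)}` of `ℂ^{N+1} ⊗ ℂ^{ν+1}`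
(identified with functions on `{0,…,N} × {0,…,ν}`): the vector `φ^{(l,λ)}` has
components `φ^{(l,λ)}_{(N-k, k+l)} = e^{2πiλk/𝒞_l}/√𝒞_l` for
`max{0,-l} ≤ k ≤ min{N, ν-l}` (equivalently, the component at `(a,b)` is nonzero
exactly when `b = (N-a) + l`, with `k = N - a` in the admissible range), all other
components being zero.  Here `𝒞_l = min{N,ν-l} - max{0,-l} + 1`.  The family indexed
by `l ∈ {-N,…,ν}` and `λ ∈ {0,…,𝒞_l - 1}` is orthonormal (and, having cardinality
`∑_l 𝒞_l = (N+1)(ν+1)`, it is an orthonormal basis). -/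
theorem measurement_basis_orthonormal (N ν : ℕ)
    (C : ℤ → ℤ) (hC : ∀ l, C l = min (N : ℤ) ((ν : ℤ) - l) - max 0 (-l) + 1)
    (φ : ℤ → ℕ → (Fin (N + 1) × Fin (ν + 1)) → ℂ)
    (hφ : ∀ l lam p, φ l lam p =
      if ((p.2 : ℕ) : ℤ) = ((N : ℤ) - ((p.1 : ℕ) : ℤ)) + l ∧
          max 0 (-l) ≤ (N : ℤ) - ((p.1 : ℕ) : ℤ) ∧
          (N : ℤ) - ((p.1 : ℕ) : ℤ) ≤ min (N : ℤ) ((ν : ℤ) - l)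
      then Complex.exp (2 * Real.pi * Complex.I * (lam : ℂ) *
              (((N : ℤ) - ((p.1 : ℕ) : ℤ) : ℤ) : ℂ) / ((C l : ℤ) : ℂ)) /
            (Real.sqrt ((C l : ℤ) : ℝ) : ℂ)
      else 0)
    (l l' : ℤ) (hl : l ∈ Finset.Icc (-(N : ℤ)) (ν : ℤ))
    (hl' : l' ∈ Finset.Icc (-(N : ℤ)) (ν : ℤ))
    (lam lam' : ℕ) (hlam : (lam : ℤ) < C l) (hlam' : (lam' : ℤ) < C l') :
    ∑ p : Fin (N + 1) × Fin (ν + 1), starRingEnd ℂ (φ l lam p) * φ l' lam' p =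
      if l = l' ∧ lam = lam' then 1 else 0 := by
  by_cases hll : l = l'
  · subst hll
    obtain ⟨c, hc⟩ : ∃ c : ℕ, C l = c := ⟨(C l).toNat, by omega⟩
    have hcpos : 0 < c := by omega
    have hc0 : (c : ℂ) ≠ 0 := by exact_mod_cast hcpos.ne'
    have hsqrt : ((Real.sqrt (c : ℝ) : ℝ) : ℂ) * ((Real.sqrt (c : ℝ) : ℝ) : ℂ) = c := by
      rw [← Complex.ofReal_mul, Real.mul_self_sqrt (Nat.cast_nonneg c), Complex.ofReal_natCast]
    have hprod : ∀ k : ℤ,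
        starRingEnd ℂ (Complex.exp (2 * Real.pi * Complex.I * (lam : ℂ) * (k : ℂ) / c) /
            (Real.sqrt (c : ℝ) : ℂ)) *
          (Complex.exp (2 * Real.pi * Complex.I * (lam' : ℂ) * (k : ℂ) / c) /
            (Real.sqrt (c : ℝ) : ℂ)) =
        Complex.exp (2 * Real.pi * Complex.I * ((lam' - lam : ℤ) : ℂ) * (k : ℂ) / c) / c := by
      intro k
      rw [map_div₀, ← Complex.exp_conj, Complex.conj_ofReal, div_mul_div_comm, hsqrt,
        ← Complex.exp_add]
      congr 2
      simp only [map_div₀, map_mul, Complex.conj_ofReal, Complex.conj_I, map_ofNat, map_natCast,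
        map_intCast]
      push_cast
      ring
    obtain ⟨f, hf⟩ : ∃ f : ℤ → ℂ, ∀ k, f k = Complex.exp (2 * Real.pi * Complex.I *
        ((lam' - lam : ℤ) : ℂ) * (k : ℂ) / c) / c := ⟨_, fun _ => rfl⟩
    have hterm : ∀ p : Fin (N + 1) × Fin (ν + 1),
        starRingEnd ℂ (φ l lam p) * φ l lam' p =
        if ((p.2 : ℕ) : ℤ) = ((N : ℤ) - ((p.1 : ℕ) : ℤ)) + l ∧
            max 0 (-l) ≤ (N : ℤ) - ((p.1 : ℕ) : ℤ) ∧
            (N : ℤ) - ((p.1 : ℕ) : ℤ) ≤ min (N : ℤ) ((ν : ℤ) - l)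
        then f ((N : ℤ) - ((p.1 : ℕ) : ℤ)) else 0 := by
      intro p
      rw [hφ, hφ, hc, Int.cast_natCast, Int.cast_natCast, hf]
      split_ifs
      · exact hprod _
      · simp
    rw [Finset.sum_congr rfl fun p _ => hterm p,
      sum_antidiagonal_rectangle (hc.symm.trans (hC l)),
      Finset.sum_congr rfl fun (j : ℕ) _ => hf (max 0 (-l) + j), ← Finset.sum_div,
      sum_range_exp_two_pi_mul_I_mul_div hcpos]
    have hdvd : (c : ℤ) ∣ (lam' : ℤ) - lam ↔ lam = lam' := by
      constructor
      · intro h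
        have := Int.eq_zero_of_abs_lt_dvd h (by rw [abs_lt]; omega)
        omega
      · rintro rfl
        simp
    by_cases h : lam = lam'
    · simp [h, hc0]
    · simp [hdvd, h]
  · rw [if_neg fun h => hll h.1]
    refine Finset.sum_eq_zero fun p _ => ?_
    rw [hφ, hφ]
    split_ifs with h h'
    · exact absurd (by omega) hll
    all_goals simp
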